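/- (Example 1.) Let ψ(t)=3t², α=3/2, β=4/3, η=1/2, ξ=1/3, λ=μ=1, Δ₁ = ψ(1/2)−ψ(1) = −9/4, Δ₂ = ψ(1/3)−ψ(1) = −8/3. Let f(t,x,y) = (e^{−3t}/(75+t))(sin x + |y|) + e^{−t}/(1+t²) and g(t,x,y) = (1/(2t²+100))(|x|/(1+|x|) + sin y) + sin t + 1. Then there exists exactly one pair of continuous functions x,y:[0,1]→ℝ satisfying, for all t∈[0,1], x(t) = (1/Γ(3/2))∫₀ᵗ 6s(3t²−3s²)^{1/2} f(s,x(s),y(s)) ds + (1/Δ₁)[ (1/Γ(3/2))∫₀¹ 6s(3−3s²)^{1/2} f(s,x(s),y(s)) ds − (1/Γ(3/2))∫₀^{1/2} 6s(3/4−3s²)^{1/2} f(s,x(s),y(s)) ds ]·3t² and y(t) = (1/Γ(4/3))∫₀ᵗ 6s(3t²−3s²)^{1/3} g(s,x(s),y(s)) ds + (1/Δ₂)[ (1/Γ(4/3))∫₀¹ 6s(3−3s²)^{1/3} g(s,x(s),y(s)) ds − (1/Γ(4/3))∫₀^{1/3} 6s(1/3−3s²)^{1/3} g(s,x(s),y(s))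 ds ]·3t². -/

import Mathlib

open MeasureTheory intervalIntegral Set Real

/-- The integral operator of the examples, with `ψ(t) = 3t²` (so `ψ'(s) = 6s` and
`ψ(t) − ψ(0) = 3t²`): given the Gamma-argument `gα`, the exponent `e = gα − 1`, the
interior point `ηv`, its image `ηψ = ψ(ηv)`, and the constant `Δ`,
`Tex gα e ηv ηψ Δ F t = (1/Γ(gα)) ∫₀ᵗ 6s(3t²−3s²)^e F(s) ds
+ (1/Δ)[ (1/Γ(gα)) ∫₀¹ 6s(3−3s²)^e F(s) ds − (1/Γ(gα)) ∫₀^{ηv} 6s(ηψ−3s²)^e F(s) ds ]·3t²`. -/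
noncomputable def Tex (gα e ηv ηψ Δ : ℝ) (F : ℝ → ℝ) (t : ℝ) : ℝ :=
  (1 / Real.Gamma gα) * (∫ s in (0:ℝ)..t, 6 * s * (3 * t ^ 2 - 3 * s ^ 2) ^ e * F s)
  + (1 / Δ) *
      ((1 / Real.Gamma gα) * (∫ s in (0:ℝ)..1, 6 * s * (3 - 3 * s ^ 2) ^ e * F s)
        - (1 / Real.Gamma gα) * (∫ s in (0:ℝ)..ηv, 6 * s * (ηψ - 3 * s ^ 2) ^ e * F s))
    * (3 * t ^ 2)

/-- A nonlocal operator on functions over `[0,1]` that only sees the values of its argument on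
`[0,1]`, sends continuous functions to continuous ones and is Lipschitz with constant `C` for the
uniform distance on `[0,1]`. -/
structure IsLipschitzOperator (T : (ℝ → ℝ) → ℝ → ℝ) (C : ℝ) : Prop where
  congr : ∀ F G : ℝ → ℝ, EqOn F G (Icc 0 1) → EqOn (T F) (T G) (Icc 0 1)
  continuous : ∀ F : ℝ → ℝ, Continuous F → Continuous (T F)
  abs_sub_le : ∀ F G : ℝ → ℝ, Continuous F → Continuous G → ∀ δ : ℝ,
    (∀ s ∈ Icc (0:ℝ) 1, |F s - G s| ≤ δ) → ∀ t ∈ Icc (0:ℝ) 1, |T F t - T G t| ≤ C * δ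

/-- A nonlinearity `f(t,u,v)` that is jointly continuous for `t ∈ [0,1]` and Lipschitz in `(u,v)`
with constant `L` for the `ℓ¹` norm. -/
structure IsLipschitzNonlinearity (f : ℝ → ℝ → ℝ → ℝ) (L : ℝ) : Prop where
  continuous : Continuous fun p : Icc (0:ℝ) 1 × ℝ × ℝ => f p.1 p.2.1 p.2.2
  abs_sub_le : ∀ t ∈ Icc (0:ℝ) 1, ∀ u v u' v' : ℝ,
    |f t u v - f t u' v'| ≤ L * (|u - u'| + |v - v'|)

/-- The superposition operator of `f`. -/
noncomputable def superposition {f : ℝ → ℝ → ℝ → ℝ} {L : ℝ} (hf : IsLipschitzNonlinearity f L)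
    (p : C(Icc (0:ℝ) 1, ℝ) × C(Icc (0:ℝ) 1, ℝ)) : C(Icc (0:ℝ) 1, ℝ) where
  toFun t := f t (p.1 t) (p.2 t)
  continuous_toFun := hf.continuous.comp
    (continuous_id.prodMk ((map_continuous p.1).prodMk (map_continuous p.2)))

/-- The action of `T` on continuous functions over `[0,1]`. -/
noncomputable def IsLipschitzOperator.toMap {T : (ℝ → ℝ) → ℝ → ℝ} {C : ℝ}
    (hT : IsLipschitzOperator T C) (w : C(Icc (0:ℝ) 1, ℝ)) : C(Icc (0:ℝ) 1, ℝ) where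
  toFun t := T (IccExtend zero_le_one w) t
  continuous_toFun :=
    (hT.continuous _ (map_continuous w).Icc_extend').comp continuous_subtype_val

lemma dist_toMap_superposition_le {T : (ℝ → ℝ) → ℝ → ℝ} {C : ℝ} (hT : IsLipschitzOperator T C)
    {f : ℝ → ℝ → ℝ → ℝ} {L : ℝ} (hf : IsLipschitzNonlinearity f L) (hC : 0 ≤ C) (hL : 0 ≤ L)
    (p q : C(Icc (0:ℝ) 1, ℝ) × C(Icc (0:ℝ) 1, ℝ)) :
    dist (hT.toMap (superposition hf p)) (hT.toMap (superposition hf q))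
      ≤ C * (2 * L) * dist p q := by
  rw [ContinuousMap.dist_le (by positivity)]
  intro t
  rw [Real.dist_eq, mul_assoc]
  refine hT.abs_sub_le _ _ (map_continuous _).Icc_extend' (map_continuous _).Icc_extend' _
    (fun s hs => ?_) t t.2
  rw [IccExtend_of_mem _ _ hs, IccExtend_of_mem _ _ hs]
  refine (hf.abs_sub_le s hs _ _ _ _).trans ?_
  have h1 := (ContinuousMap.dist_apply_le_dist (f := p.1) (g := q.1) ⟨s, hs⟩).trans
    (le_max_left _ (dist p.2 q.2))
  have h2 := (ContinuousMap.dist_apply_le_dist (f := p.2) (g := q.2) ⟨s, hs⟩).trans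
    (le_max_right (dist p.1 q.1) _)
  rw [← Prod.dist_eq, Real.dist_eq] at h1 h2
  nlinarith

/-- A coupled system `x = S (f(·,x,y))`, `y = T (g(·,x,y))` of Lipschitz operators and
nonlinearities with small constants has exactly one continuous solution on `[0,1]`. -/
theorem exists_unique_solution_coupled_system {S T : (ℝ → ℝ) → ℝ → ℝ} {A B : ℝ}
    (hS : IsLipschitzOperator S A) (hT : IsLipschitzOperator T B) {f g : ℝ → ℝ → ℝ → ℝ} {L M : ℝ}
    (hf : IsLipschitzNonlinearity f L) (hg : IsLipschitzNonlinearity g M)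
    (hA : 0 ≤ A) (hB : 0 ≤ B) (hL : 0 ≤ L) (hM : 0 ≤ M)
    (hAL : A * (2 * L) < 1) (hBM : B * (2 * M) < 1) :
    ∃ x y : ℝ → ℝ,
      (ContinuousOn x (Icc 0 1) ∧ ContinuousOn y (Icc 0 1) ∧
        ∀ t ∈ Icc (0:ℝ) 1,
          x t = S (fun s => f s (x s) (y s)) t ∧ y t = T (fun s => g s (x s) (y s)) t) ∧
      ∀ x' y' : ℝ → ℝ,
        (ContinuousOn x' (Icc 0 1) ∧ ContinuousOn y' (Icc 0 1) ∧
          ∀ t ∈ Icc (0:ℝ) 1,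
            x' t = S (fun s => f s (x' s) (y' s)) t ∧
            y' t = T (fun s => g s (x' s) (y' s)) t) →
        EqOn x x' (Icc 0 1) ∧ EqOn y y' (Icc 0 1) := by
  let Φ : C(Icc (0:ℝ) 1, ℝ) × C(Icc (0:ℝ) 1, ℝ) → C(Icc (0:ℝ) 1, ℝ) × C(Icc (0:ℝ) 1, ℝ) :=
    fun p => (hS.toMap (superposition hf p), hT.toMap (superposition hg p))
  let K : NNReal := ⟨max (A * (2 * L)) (B * (2 * M)), by positivity⟩
  have hΦ : ContractingWith K Φ := by
    refine ⟨?_, LipschitzWith.of_dist_le_mul fun p q => ?_⟩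
    · rw [← NNReal.coe_lt_coe]
      exact max_lt hAL hBM
    · rw [Prod.dist_eq]
      refine max_le ((dist_toMap_superposition_le hS hf hA hL p q).trans ?_)
        ((dist_toMap_superposition_le hT hg hB hM p q).trans ?_)
      · exact mul_le_mul_of_nonneg_right (le_max_left _ _) dist_nonneg
      · exact mul_le_mul_of_nonneg_right (le_max_right _ _) dist_nonneg
  have hfix := hΦ.fixedPoint_isFixedPt
  set p := hΦ.fixedPoint
  refine ⟨IccExtend zero_le_one p.1, IccExtend zero_le_one p.2,
    ⟨(map_continuous p.1).Icc_extend'.continuousOn, (map_continuous p.2).Icc_extend'.continuousOn,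
      fun t ht => ⟨?_, ?_⟩⟩, ?_⟩
  · rw [IccExtend_of_mem _ _ ht]
    have h1 := DFunLike.congr_fun (congrArg Prod.fst hfix) (⟨t, ht⟩ : Icc (0:ℝ) 1)
    rw [← h1]
    refine hS.congr _ _ (fun s hs => ?_) ht
    simp only [IccExtend_of_mem _ _ hs]
    rfl
  · rw [IccExtend_of_mem _ _ ht]
    have h1 := DFunLike.congr_fun (congrArg Prod.snd hfix) (⟨t, ht⟩ : Icc (0:ℝ) 1)
    rw [← h1]
    refine hT.congr _ _ (fun s hs => ?_) ht
    simp only [IccExtend_of_mem _ _ hs]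
    rfl
  · rintro x' y' ⟨hx, hy, h⟩
    let q : C(Icc (0:ℝ) 1, ℝ) × C(Icc (0:ℝ) 1, ℝ) :=
      (⟨(Icc 0 1).domRestrict x', hx.domRestrict⟩, ⟨(Icc 0 1).domRestrict y', hy.domRestrict⟩)
    have hq : Function.IsFixedPt Φ q := by
      refine Prod.ext (ContinuousMap.ext fun t => ?_) (ContinuousMap.ext fun t => ?_)
      · refine Eq.trans (hS.congr _ _ (fun s hs => ?_) t.2) (h t t.2).1.symm
        rw [IccExtend_of_mem _ _ hs]
        rfl
      · refine Eq.trans (hT.congr _ _ (fun s hs => ?_) t.2) (h t t.2).2.symm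
        rw [IccExtend_of_mem _ _ hs]
        rfl
    have hqp : q = p := hΦ.fixedPoint_unique hq
    constructor <;> intro t ht <;> simp only [IccExtend_of_mem _ _ ht, ← hqp] <;> rfl

lemma continuous_kernel {e : ℝ} (he : 0 < e) :
    Continuous fun p : ℝ × ℝ => 6 * p.2 * (p.1 - 3 * p.2 ^ 2) ^ e :=
  Continuous.mul (by fun_prop) (Continuous.rpow_const (by fun_prop) fun _ => Or.inr he.le)

lemma intervalIntegrable_kernel_mul {e : ℝ} (he : 0 < e) {F : ℝ → ℝ} (hF : Continuous F)
    (c a b : ℝ) :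
    IntervalIntegrable (fun s => 6 * s * (c - 3 * s ^ 2) ^ e * F s) volume a b :=
  (((continuous_kernel he).comp (by fun_prop : Continuous fun s : ℝ => (c, s))).mul
    hF).intervalIntegrable a b

lemma integral_kernel_mul_congr {F G : ℝ → ℝ} (h : EqOn F G (Icc 0 1)) (e c : ℝ) {a : ℝ}
    (ha : a ∈ Icc (0:ℝ) 1) :
    (∫ s in (0:ℝ)..a, 6 * s * (c - 3 * s ^ 2) ^ e * F s)
      = ∫ s in (0:ℝ)..a, 6 * s * (c - 3 * s ^ 2) ^ e * G s := by
  refine integral_congr fun s hs => ?_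
  rw [uIcc_of_le ha.1] at hs
  simp only [h ⟨hs.1, hs.2.trans ha.2⟩]

lemma abs_integral_kernel_mul_sub_le {e : ℝ} (he : 0 < e) (he' : e ≤ 1 / 2) {F G : ℝ → ℝ}
    (hF : Continuous F) (hG : Continuous G) {δ : ℝ}
    (h : ∀ s ∈ Icc (0:ℝ) 1, |F s - G s| ≤ δ) {a c : ℝ} (ha : a ∈ Icc (0:ℝ) 1)
    (hc : c = 3 * a ^ 2) :
    |(∫ s in (0:ℝ)..a, 6 * s * (c - 3 * s ^ 2) ^ e * F s)
      - ∫ s in (0:ℝ)..a, 6 * s * (c - 3 * s ^ 2) ^ e * G s| ≤ 12 * a ^ 2 * δ := by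
  rw [← integral_sub (intervalIntegrable_kernel_mul he hF _ _ _)
    (intervalIntegrable_kernel_mul he hG _ _ _), ← Real.norm_eq_abs,
    show 12 * a ^ 2 * δ = 12 * a * δ * a by ring]
  obtain ⟨ha0, ha1⟩ := ha
  have hδ : 0 ≤ δ := (abs_nonneg _).trans (h 0 (by norm_num))
  refine (intervalIntegral.norm_integral_le_of_norm_le_const (C := 12 * a * δ) fun s hs => ?_).trans
    (le_of_eq (by rw [sub_zero, abs_of_nonneg ha0]))
  rw [uIoc_of_le ha0] at hs
  obtain ⟨hs0, hsa⟩ := hs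
  have hbase : 0 ≤ c - 3 * s ^ 2 := by nlinarith
  have hpow : (c - 3 * s ^ 2) ^ e ≤ 2 := calc
    (c - 3 * s ^ 2) ^ e ≤ 4 ^ e := Real.rpow_le_rpow hbase (by nlinarith) he.le
    _ ≤ 4 ^ (1 / 2 : ℝ) := Real.rpow_le_rpow_of_exponent_le (by norm_num) he'
    _ = 2 := by
      rw [← Real.sqrt_eq_rpow, show (4:ℝ) = 2 ^ 2 by norm_num, Real.sqrt_sq (by norm_num)]
  have hpow0 := Real.rpow_nonneg hbase e
  rw [← mul_sub, norm_mul, Real.norm_eq_abs, Real.norm_eq_abs, abs_of_nonneg (by positivity)]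
  refine mul_le_mul ?_ (h s ⟨hs0.le, hsa.trans ha1⟩) (abs_nonneg _) (by positivity)
  nlinarith

lemma isLipschitzOperator_Tex {gα e ηv ηψ Δ : ℝ} (hgα : 0 < gα) (he : 0 < e) (he' : e ≤ 1 / 2)
    (hη : ηv ∈ Icc (0:ℝ) 1) (hψ : ηψ = 3 * ηv ^ 2) :
    IsLipschitzOperator (Tex gα e ηv ηψ Δ)
      (12 / Real.Gamma gα * (1 + 3 / |Δ| * (1 + ηv ^ 2))) where
  congr F G h t ht := by
    simp only [Tex, integral_kernel_mul_congr h _ _ ht, integral_kernel_mul_congr h _ _ hη,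
      integral_kernel_mul_congr h _ _ (right_mem_Icc.2 zero_le_one)]
  continuous F hF := by
    have h : Continuous fun t : ℝ =>
        ∫ s in (0:ℝ)..t, 6 * s * (3 * t ^ 2 - 3 * s ^ 2) ^ e * F s := by
      refine continuous_parametric_intervalIntegral_of_continuous ?_ continuous_id
      exact ((continuous_kernel he).comp
        (by fun_prop : Continuous fun p : ℝ × ℝ => (3 * p.1 ^ 2, p.2))).mul (hF.comp continuous_snd)
    unfold Tex
    fun_prop
  abs_sub_le F G hF hG δ h t ht := by
    have hδ : 0 ≤ δ := (abs_nonneg _).trans (h 0 (by norm_num))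
    have h1 := abs_integral_kernel_mul_sub_le he he' hF hG h ht rfl
    have h2 := abs_integral_kernel_mul_sub_le he he' hF hG h (right_mem_Icc.2 zero_le_one)
      (c := 3) (by norm_num)
    have h3 := abs_integral_kernel_mul_sub_le he he' hF hG h hη hψ
    have hΓ := Real.Gamma_pos_of_pos hgα
    have ht2 : t ^ 2 ≤ 1 := pow_le_one₀ ht.1 ht.2
    unfold Tex
    generalize (∫ s in (0:ℝ)..t, 6 * s * (3 * t ^ 2 - 3 * s ^ 2) ^ e * F s) = I₁ at *
    generalize (∫ s in (0:ℝ)..t, 6 * s * (3 * t ^ 2 - 3 * s ^ 2) ^ e * G s) = J₁ at *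
    generalize (∫ s in (0:ℝ)..1, 6 * s * (3 - 3 * s ^ 2) ^ e * F s) = I₂ at *
    generalize (∫ s in (0:ℝ)..1, 6 * s * (3 - 3 * s ^ 2) ^ e * G s) = J₂ at *
    generalize (∫ s in (0:ℝ)..ηv, 6 * s * (ηψ - 3 * s ^ 2) ^ e * F s) = I₃ at *
    generalize (∫ s in (0:ℝ)..ηv, 6 * s * (ηψ - 3 * s ^ 2) ^ e * G s) = J₃ at *
    calc _ = |1 / Real.Gamma gα *
          ((I₁ - J₁) + 1 / Δ * ((I₂ - J₂) - (I₃ - J₃)) * (3 * t ^ 2))| := by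
          congr 1; ring
      _ ≤ 1 / Real.Gamma gα *
          (|I₁ - J₁| + 1 / |Δ| * (|I₂ - J₂| + |I₃ - J₃|) * (3 * t ^ 2)) := by
          rw [abs_mul, abs_of_pos (one_div_pos.2 hΓ)]
          gcongr
          refine (abs_add_le _ _).trans ?_
          rw [abs_mul, abs_mul, abs_div, abs_one, abs_of_nonneg (by positivity : 0 ≤ 3 * t ^ 2)]
          gcongr
          exact abs_sub _ _
      _ ≤ 1 / Real.Gamma gα *
          (12 * 1 * δ + 1 / |Δ| * (12 * 1 ^ 2 * δ + 12 * ηv ^ 2 * δ) * (3 * 1)) := by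
          gcongr
          exact h1.trans (by gcongr)
      _ = _ := by ring

lemma abs_div_one_add_abs_sub_le (u v : ℝ) :
    |(|u| / (1 + |u|)) - |v| / (1 + |v|)| ≤ |u - v| := by
  have h : |u| / (1 + |u|) - |v| / (1 + |v|) = (|u| - |v|) / ((1 + |u|) * (1 + |v|)) := by
    field_simp
    ring
  rw [h, abs_div, abs_of_pos (by positivity : 0 < (1 + |u|) * (1 + |v|))]
  refine (div_le_self (abs_nonneg _) ?_).trans (abs_abs_sub_abs_le _ _)
  nlinarith [abs_nonneg u, abs_nonneg v, mul_nonneg (abs_nonneg u) (abs_nonneg v)]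

lemma le_Gamma_three_halves : (22 / 25 : ℝ) ≤ Real.Gamma (3 / 2) := by
  have h : Real.Gamma (3 / 2) = 1 / 2 * √π := by
    rw [show (3 / 2 : ℝ) = 1 / 2 + 1 by norm_num, Real.Gamma_add_one (by norm_num),
      Real.Gamma_one_half_eq]
  have : (44 / 25 : ℝ) ≤ √π := Real.le_sqrt_of_sq_le (by linarith [Real.pi_gt_d2])
  linarith

lemma le_Gamma_four_thirds : (21 / 25 : ℝ) ≤ Real.Gamma (4 / 3) := by
  have h := Real.convexOn_Gamma.2 (Set.mem_Ioi.2 (by norm_num : (0:ℝ) < 4 / 3))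
    (Set.mem_Ioi.2 (by norm_num : (0:ℝ) < 2)) (by norm_num : (0:ℝ) ≤ 3 / 4)
    (by norm_num : (0:ℝ) ≤ 1 / 4) (by norm_num)
  norm_num [Real.Gamma_two] at h
  linarith [le_Gamma_three_halves]

/-- **Example 1 of the paper.**
With `ψ(t) = 3t²`, `α = 3/2`, `β = 4/3`, `η = 1/2`, `ξ = 1/3`, `λ = μ = 1`,
`Δ₁ = ψ(1/2) − ψ(1) = −9/4`, `Δ₂ = ψ(1/3) − ψ(1) = −8/3`,
`f(t,x,y) = (e^{−3t}/(75+t))(sin x + |y|) + e^{−t}/(1+t²)` and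
`g(t,x,y) = (1/(2t²+100))(|x|/(1+|x|) + sin y) + sin t + 1`, the coupled system of
integral equations has exactly one pair of continuous solutions on `[0,1]`. -/
theorem example_one_unique_solution
    (f g : ℝ → ℝ → ℝ → ℝ)
    (hf : ∀ t u v : ℝ, f t u v =
      (Real.exp (-3 * t) / (75 + t)) * (Real.sin u + |v|) + Real.exp (-t) / (1 + t ^ 2))
    (hg : ∀ t u v : ℝ, g t u v =
      (1 / (2 * t ^ 2 + 100)) * (|u| / (1 + |u|) + Real.sin v) + Real.sin t + 1) :
    ∃ x y : ℝ → ℝ,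
      (ContinuousOn x (Icc 0 1) ∧ ContinuousOn y (Icc 0 1) ∧
        ∀ t ∈ Icc (0:ℝ) 1,
          x t = Tex (3/2) (1/2) (1/2) (3/4) (-(9/4)) (fun s => f s (x s) (y s)) t ∧
          y t = Tex (4/3) (1/3) (1/3) (1/3) (-(8/3)) (fun s => g s (x s) (y s)) t) ∧
      ∀ x' y' : ℝ → ℝ,
        (ContinuousOn x' (Icc 0 1) ∧ ContinuousOn y' (Icc 0 1) ∧
          ∀ t ∈ Icc (0:ℝ) 1,
            x' t = Tex (3/2) (1/2) (1/2) (3/4) (-(9/4)) (fun s => f s (x' s) (y' s)) t ∧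
            y' t = Tex (4/3) (1/3) (1/3) (1/3) (-(8/3)) (fun s => g s (x' s) (y' s)) t) →
        EqOn x x' (Icc 0 1) ∧ EqOn y y' (Icc 0 1) := by
  have hF : IsLipschitzNonlinearity f (1 / 75) := by
    refine ⟨?_, fun t ht u v u' v' => ?_⟩
    · simp only [hf]
      refine Continuous.add (Continuous.mul (Continuous.div (by fun_prop) (by fun_prop)
        fun p => ?_) (by fun_prop)) (Continuous.div (by fun_prop) (by fun_prop) fun p => ?_)
      · have := p.1.2.1
        positivity
      · positivity
    · have ht0 := ht.1
      have hc : Real.exp (-3 * t) / (75 + t) ≤ 1 / 75 :=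
        div_le_div₀ zero_le_one (Real.exp_le_one_iff.2 (by linarith)) (by norm_num) (by linarith)
      rw [hf, hf, add_sub_add_right_eq_sub, ← mul_sub, abs_mul, abs_of_nonneg (by positivity)]
      refine mul_le_mul hc ?_ (abs_nonneg _) (by norm_num)
      rw [add_sub_add_comm]
      exact (abs_add_le _ _).trans
        (add_le_add (abs_sin_sub_sin_le _ _) (abs_abs_sub_abs_le _ _))
  have hG : IsLipschitzNonlinearity g (1 / 100) := by
    refine ⟨?_, fun t ht u v u' v' => ?_⟩
    · simp only [hg]
      refine Continuous.add (Continuous.add (Continuous.mul (Continuous.div (by fun_prop)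
        (by fun_prop) fun p => ?_) (Continuous.add (Continuous.div (by fun_prop) (by fun_prop)
        fun p => ?_) (by fun_prop))) (by fun_prop)) (by fun_prop)
      · positivity
      · positivity
    · have hc : 1 / (2 * t ^ 2 + 100) ≤ 1 / 100 :=
        one_div_le_one_div_of_le (by norm_num) (by nlinarith [sq_nonneg t])
      rw [hg, hg, add_sub_add_right_eq_sub, add_sub_add_right_eq_sub, ← mul_sub, abs_mul,
        abs_of_nonneg (by positivity : 0 ≤ 1 / (2 * t ^ 2 + 100))]
      refine mul_le_mul hc ?_ (abs_nonneg _) (by norm_num)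
      rw [add_sub_add_comm]
      exact (abs_add_le _ _).trans
        (add_le_add (abs_div_one_add_abs_sub_le _ _) (abs_sin_sub_sin_le _ _))
  have hΓ₁ := le_Gamma_three_halves
  have hΓ₂ := le_Gamma_four_thirds
  have hΓ₁' : 0 < Real.Gamma (3 / 2) := by linarith
  have hΓ₂' : 0 < Real.Gamma (4 / 3) := by linarith
  refine exists_unique_solution_coupled_system
    (isLipschitzOperator_Tex (by norm_num) (by norm_num) (by norm_num) (by norm_num) (by norm_num))
    (isLipschitzOperator_Tex (by norm_num) (by norm_num) (by norm_num) (by norm_num) (by norm_num))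
    hF hG (by positivity) (by positivity) (by norm_num) (by norm_num) ?_ ?_
  · rw [abs_neg, abs_of_pos (by norm_num), div_mul_eq_mul_div, div_mul_eq_mul_div, div_lt_one hΓ₁']
    linarith
  · rw [abs_neg, abs_of_pos (by norm_num), div_mul_eq_mul_div, div_mul_eq_mul_div, div_lt_one hΓ₂']
    linarith
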